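/- Let G be a group, let φ : G → ℝ be a homogeneous quasi-morphism with |φ(xy) − φ(x) − φ(y)| ≤ D for all x, y ∈ G, let T_1, …, T_n ∈ G (n ≥ 2) satisfy T_i T_j = T_j T_i whenever |i − j| ≥ 2, and let ι, S ∈ G be such that ι has finite order, ι S = S ι, and T_1 T_2 ⋯ T_n = ι S^{-1}. Then |φ(S) + φ(T_1) + φ(T_2) + ⋯ + φ(T_n)| ≤ D. -/

import Mathlib

theorem eq_zero_of_forall_nat_mul_abs_le {a C : ℝ} (h : ∀ n : ℕ, n * |a| ≤ C) : a = 0 := by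
  by_contra ha
  obtain ⟨n, hn⟩ := exists_nat_gt (C / |a|)
  exact absurd (h n) (not_le.2 ((div_lt_iff₀ (abs_pos.2 ha)).1 hn))

section HomogeneousQuasimorphism

variable {G : Type*} [Group G] {φ : G → ℝ} {D : ℝ}

theorem map_mul_of_commute_of_homogeneous_quasimorphism
    (hquasi : ∀ x y : G, |φ (x * y) - φ x - φ y| ≤ D)
    (hhom : ∀ (x : G) (n : ℤ), φ (x ^ n) = n * φ x) {x y : G} (h : Commute x y) :
    φ (x * y) = φ x + φ y := by
  suffices φ (x * y) - φ x - φ y = 0 by linarith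
  refine eq_zero_of_forall_nat_mul_abs_le (C := D) fun n => ?_
  have key := hquasi (x ^ (n : ℤ)) (y ^ (n : ℤ))
  rw [← h.mul_zpow, hhom, hhom, hhom, ← mul_sub, ← mul_sub, abs_mul] at key
  simpa using key

theorem map_conj_of_homogeneous_quasimorphism
    (hquasi : ∀ x y : G, |φ (x * y) - φ x - φ y| ≤ D)
    (hhom : ∀ (x : G) (n : ℤ), φ (x ^ n) = n * φ x) (g x : G) :
    φ (g * x * g⁻¹) = φ x := by
  suffices φ (g * x * g⁻¹) - φ x = 0 by linarith
  refine eq_zero_of_forall_nat_mul_abs_le (C := 2 * D) fun n => ?_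
  have h₁ := hquasi (g * x ^ (n : ℤ)) g⁻¹
  have h₂ := hquasi g (x ^ (n : ℤ))
  have hinv : φ g⁻¹ = -φ g := by simpa using hhom g (-1)
  rw [← conj_zpow, hhom, hinv] at h₁
  rw [hhom] at h₂
  have key : |(n : ℝ) * (φ (g * x * g⁻¹) - φ x)| ≤ 2 * D := by
    rw [abs_le] at h₁ h₂ ⊢
    push_cast at h₁ h₂
    constructor <;> linarith
  simpa [abs_mul] using key

theorem map_eq_zero_of_pow_eq_one_of_homogeneous
    (hhom : ∀ (x : G) (n : ℤ), φ (x ^ n) = n * φ x) {x : G} {m : ℕ} (hm : 1 ≤ m)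
    (h : x ^ m = 1) : φ x = 0 := by
  have h_one : φ 1 = 0 := by simpa using hhom 1 0
  have key := hhom x m
  rw [zpow_natCast, h, h_one] at key
  have hm' : (m : ℝ) ≠ 0 := by positivity
  simpa [hm'] using key.symm

/-- If non-neighbouring elements of `T 1, …, T n` commute, then `T 1 ⋯ T k` is conjugate to a
product of two blocks: `Y`, the product of the `T i` with `i` of the parity of `k`, and `Z`, the
product of the others. -/
theorem exists_conj_two_blocks
    (hquasi : ∀ x y : G, |φ (x * y) - φ x - φ y| ≤ D)
    (hhom : ∀ (x : G) (n : ℤ), φ (x ^ n) = n * φ x) {n : ℕ} {T : ℕ → G}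
    (hcomm : ∀ i j, 1 ≤ i → j ≤ n → i + 2 ≤ j → T i * T j = T j * T i) (k : ℕ) (hk : k ≤ n) :
    ∃ g Y Z : G, ((List.range k).map fun i => T (i + 1)).prod = g * (Y * Z) * g⁻¹ ∧
      φ Y + φ Z = ∑ i ∈ Finset.range k, φ (T (i + 1)) ∧
      (∀ j, k + 1 ≤ j → j ≤ n → Commute g (T j)) ∧
      (∀ j, k + 2 ≤ j → j ≤ n → Commute Y (T j)) ∧
      ∀ j, k + 1 ≤ j → j ≤ n → Commute Z (T j) := by
  induction k with
  | zero =>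
    have h_one : φ 1 = 0 := by simpa using hhom 1 0
    exact ⟨1, 1, 1, by simp, by simp [h_one], by simp, by simp, by simp⟩
  | succ k ih =>
    obtain ⟨g, Y, Z, hP, hsum, hg, hY, hZ⟩ := ih (by lia)
    refine ⟨g * Y, Z * T (k + 1), Y, ?_, ?_, fun j hj hjn => ?_, fun j hj hjn => ?_,
      fun j hj hjn => hY j (by lia) hjn⟩
    · have hgT : g⁻¹ * T (k + 1) = T (k + 1) * g⁻¹ := (hg (k + 1) le_rfl hk).inv_left
      rw [List.range_succ, List.map_append, List.prod_append, hP, List.map_singleton,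
        List.prod_singleton, mul_assoc, hgT]
      group
    · rw [map_mul_of_commute_of_homogeneous_quasimorphism hquasi hhom (hZ (k + 1) le_rfl hk),
        Finset.sum_range_succ, ← hsum]
      ring
    · exact (hg j (by lia) hjn).mul_left (hY j (by lia) hjn)
    · exact (hZ j (by lia) hjn).mul_left (hcomm (k + 1) j (by lia) hjn (by lia))

end HomogeneousQuasimorphism

/-- the abstract core of the main theorem.  Let `φ : G → ℝ` be a
homogeneous quasi-morphism with defect bound `D`, let `T_1, …, T_n ∈ G` (`n ≥ 2`) satisfy
`T_i T_j = T_j T_i` for `|i − j| ≥ 2`, and let `ι, S ∈ G` with `ι` of finite order,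
`ι S = S ι` and `T_1 T_2 ⋯ T_n = ι S⁻¹`.  Then
`|φ(S) + φ(T_1) + φ(T_2) + ⋯ + φ(T_n)| ≤ D`. -/
theorem defect_estimate_main {G : Type*} [Group G] (φ : G → ℝ)
    (D : ℝ) (hD : 0 ≤ D)
    (hquasi : ∀ x y : G, |φ (x * y) - φ x - φ y| ≤ D)
    (hhom : ∀ (x : G) (n : ℤ), φ (x ^ n) = n * φ x)
    (n : ℕ) (hn : 2 ≤ n) (T : ℕ → G)
    (hcomm : ∀ i j, 1 ≤ i → j ≤ n → i + 2 ≤ j → T i * T j = T j * T i)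
    (ι S : G) (hι : ∃ m : ℕ, 1 ≤ m ∧ ι ^ m = 1) (hιS : ι * S = S * ι)
    (hprod : ((List.range n).map fun i => T (i + 1)).prod = ι * S⁻¹) :
    |φ S + ∑ i ∈ Finset.range n, φ (T (i + 1))| ≤ D := by
  obtain ⟨m, hm, hιm⟩ := hι
  obtain ⟨g, Y, Z, hP, hsum, -⟩ := exists_conj_two_blocks hquasi hhom hcomm n le_rfl
  have hS : φ S⁻¹ = -φ S := by simpa using hhom S (-1)
  have hιS' : Commute ι S := hιS
  have hYZ : φ (Y * Z) = -φ S := by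
    rw [← map_conj_of_homogeneous_quasimorphism hquasi hhom g (Y * Z), ← hP, hprod,
      map_mul_of_commute_of_homogeneous_quasimorphism hquasi hhom hιS'.inv_right, hS,
      map_eq_zero_of_pow_eq_one_of_homogeneous hhom hm hιm, zero_add]
  have key := hquasi Y Z
  rw [hYZ] at key
  rw [← hsum, ← abs_neg]
  convert key using 2
  ring
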